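/- Fix an integer k ≥ 2. For all Q > 0 and X > 0, the variance Δ_k(Q;X) satisfies the exact decomposition Δ_k(Q;X) = D_k(Q;X) − B_k(Q;X) + MG_k(Q;X) + EG_k(Q;X). -/

import Mathlib

open MeasureTheory Complex
open scoped Classical

/-- `d_k(n)`: number of ordered k-tuples of positive integers with product n. -/
noncomputable def dk (k n : ℕ) : ℕ :=
  Nat.card {f : Fin k → ℕ // (∀ i, 0 < f i) ∧ ∏ i, f i = n}

/-- sum over `n ≡ a (mod q)` of `d_k(n) Ψ(n/X)`. -/
noncomputable def progSum (k : ℕ) (Ψ : ℝ → ℝ) (q a : ℕ) (X : ℝ) : ℝ :=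
  ∑' n : ℕ, if (n : ZMod q) = (a : ZMod q) then (dk k n : ℝ) * Ψ ((n : ℝ) / X) else 0

/-- sum over `n` coprime to `q` of `d_k(n) Ψ(n/X)`. -/
noncomputable def copSum (k : ℕ) (Ψ : ℝ → ℝ) (q : ℕ) (X : ℝ) : ℝ :=
  ∑' n : ℕ, if Nat.gcd n q = 1 then (dk k n : ℝ) * Ψ ((n : ℝ) / X) else 0

/-- `V_k(q; X)`. -/
noncomputable def Vk (k : ℕ) (Ψ : ℝ → ℝ) (q : ℕ) (X : ℝ) : ℝ :=
  ∑ a ∈ Finset.Icc 1 q, if Nat.gcd a q = 1 then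
    (progSum k Ψ q a X - (1 / (Nat.totient q : ℝ)) * copSum k Ψ q X)^2 else 0

/-- `Δ_k(Q; X)`. -/
noncomputable def DeltaK (k : ℕ) (Φ Ψ : ℝ → ℝ) (Q X : ℝ) : ℝ :=
  ∑' q : ℕ, if 1 ≤ q then Vk k Ψ q X * Φ ((q : ℝ) / Q) else 0

/-- The diagonal sum `D_k(Q;X)`. -/
noncomputable def Dk (k : ℕ) (Φ Ψ : ℝ → ℝ) (Q X : ℝ) : ℝ :=
  ∑' q : ℕ, if 1 ≤ q then
    Φ ((q : ℝ) / Q) *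
      ∑' n : ℕ, (if Nat.gcd n q = 1 then (dk k n : ℝ)^2 * (Ψ ((n : ℝ) / X))^2 else 0)
  else 0

/-- `B_k(Q;X)`. -/
noncomputable def Bk (k : ℕ) (Φ Ψ : ℝ → ℝ) (Q X : ℝ) : ℝ :=
  ∑' q : ℕ, if 1 ≤ q then
    Φ ((q : ℝ) / Q) * (1 / (Nat.totient q : ℝ)) * (copSum k Ψ q X)^2
  else 0

/-- The off-diagonal main term `MG_k(Q;X)`. -/
noncomputable def MGk (k : ℕ) (Φ Ψ : ℝ → ℝ) (Q X : ℝ) : ℝ :=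
  ∑' m : ℕ, ∑' n : ℕ, ∑' a : ℕ, ∑' r : ℕ,
    if 1 ≤ m ∧ 1 ≤ n ∧ 1 ≤ r ∧ a ∣ Nat.gcd m n ∧
        Nat.gcd (a * r) ((m / Nat.gcd m n) * (n / Nat.gcd m n)) = 1 then
      (dk k m : ℝ) * (dk k n : ℝ) * Ψ ((m : ℝ) / X) * Ψ ((n : ℝ) / X) *
        (((ArithmeticFunction.moebius a : ℤ) : ℝ) / (Nat.totient (a * r) : ℝ)) *
        Φ (|((m / Nat.gcd m n : ℕ) : ℝ) - ((n / Nat.gcd m n : ℕ) : ℝ)| / ((r : ℝ) * Q))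
    else 0

/-- The off-diagonal error term `EG_k(Q;X)`, a sum over non-principal Dirichlet
characters. -/
noncomputable def EGk (k : ℕ) (Φ Ψ : ℝ → ℝ) (Q X : ℝ) : ℂ :=
  ∑' m : ℕ, ∑' n : ℕ, ∑' a : ℕ, ∑' r : ℕ,
    if 1 ≤ m ∧ 1 ≤ n ∧ 1 ≤ r ∧ a ∣ Nat.gcd m n then
      (((dk k m : ℝ) * (dk k n : ℝ) * Ψ ((m : ℝ) / X) * Ψ ((n : ℝ) / X) *
          (((ArithmeticFunction.moebius a : ℤ) : ℝ) / (Nat.totient (a * r) : ℝ)) *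
          Φ (|((m / Nat.gcd m n : ℕ) : ℝ) - ((n / Nat.gcd m n : ℕ) : ℝ)| /
              ((r : ℝ) * Q)) : ℝ) : ℂ) *
        ∑' χ : DirichletCharacter ℂ (a * r),
          (if χ ≠ 1 then
            χ (((m / Nat.gcd m n : ℕ) : ZMod (a * r))) *
              (starRingEnd ℂ) (χ (((n / Nat.gcd m n : ℕ) : ZMod (a * r))))
          else 0)
    else 0

lemma coprime_of_modEq_of_coprime {q M N : ℕ} (hMN : Nat.Coprime M N) (h : M ≡ N [MOD q]) :
    Nat.Coprime M q := by
  have hM := Nat.gcd_dvd_left M q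
  exact Nat.dvd_one.1 (hMN ▸ Nat.dvd_gcd hM ((h.dvd_iff (Nat.gcd_dvd_right M q)).1 hM))

/-- Orthogonality of characters with the principal character split off, for coprime arguments. -/
lemma principal_add_sum_nonprincipal {q M N : ℕ} (hq : q ≠ 0) (hMN : Nat.Coprime M N) :
    (if Nat.gcd q (M * N) = 1 then (1 : ℂ) else 0) +
        ∑' χ : DirichletCharacter ℂ q,
          (if χ ≠ 1 then χ (M : ZMod q) * (starRingEnd ℂ) (χ (N : ZMod q)) else 0) =
      if M ≡ N [MOD q] then (q.totient : ℂ) else 0 := by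
  have : NeZero q := ⟨hq⟩
  have hone (x : ℕ) : (1 : DirichletCharacter ℂ q) (x : ZMod q) =
      if Nat.Coprime x q then 1 else 0 := by
    split_ifs with h
    · exact MulChar.one_apply ((ZMod.isUnit_iff_coprime x q).2 h)
    · exact MulChar.map_nonunit _ (mt (ZMod.isUnit_iff_coprime x q).1 h)
  have hprincipal : (if Nat.gcd q (M * N) = 1 then (1 : ℂ) else 0) =
      (1 : DirichletCharacter ℂ q) (M : ZMod q) *
        (starRingEnd ℂ) ((1 : DirichletCharacter ℂ q) (N : ZMod q)) := by
    have hgcd : Nat.gcd q (M * N) = 1 ↔ Nat.Coprime M q ∧ Nat.Coprime N q := by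
      rw [← Nat.coprime_iff_gcd_eq_one, Nat.coprime_mul_iff_right, Nat.coprime_comm,
        Nat.coprime_comm (m := N)]
    rw [hone, hone]
    split_ifs <;> simp_all
  have hsum : (if Nat.gcd q (M * N) = 1 then (1 : ℂ) else 0) +
        ∑' χ : DirichletCharacter ℂ q,
          (if χ ≠ 1 then χ (M : ZMod q) * (starRingEnd ℂ) (χ (N : ZMod q)) else 0) =
      ∑ χ : DirichletCharacter ℂ q, χ (M : ZMod q) * (starRingEnd ℂ) (χ (N : ZMod q)) := by
    rw [tsum_fintype, hprincipal, ← Finset.sum_filter, Finset.filter_ne']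
    exact Finset.add_sum_erase Finset.univ
      (fun χ : DirichletCharacter ℂ q ↦ χ (M : ZMod q) * (starRingEnd ℂ) (χ (N : ZMod q)))
      (Finset.mem_univ 1)
  suffices h : ∑ χ : DirichletCharacter ℂ q,
      χ (M : ZMod q) * (starRingEnd ℂ) (χ (N : ZMod q)) =
        if M ≡ N [MOD q] then (q.totient : ℂ) else 0 by
    rw [← h, ← hsum]
    congr!
  by_cases hN : IsUnit (N : ZMod q)
  · have key := DirichletCharacter.sum_char_inv_mul_char_eq ℂ hN (M : ZMod q)
    have heq : (N : ZMod q) = (M : ZMod q) ↔ M ≡ N [MOD q] := by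
      rw [eq_comm, ZMod.natCast_eq_natCast_iff]
    simp only [heq] at key
    rw [← key]
    refine Finset.sum_congr rfl fun χ _ ↦ ?_
    have hinv : χ (N : ZMod q)⁻¹ = (starRingEnd ℂ) (χ (N : ZMod q)) := by
      rw [starRingEnd_apply, MulChar.star_apply', MulChar.inv_apply_eq_inv']
      refine eq_inv_of_mul_eq_one_left ?_
      rw [← map_mul, ZMod.inv_mul_of_unit _ hN, map_one]
    rw [hinv, mul_comm]
  · have hne : ¬ M ≡ N [MOD q] :=
      fun h ↦ hN ((ZMod.isUnit_iff_coprime N q).2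
        (coprime_of_modEq_of_coprime hMN.symm h.symm))
    simp [MulChar.map_nonunit _ hN, hne]

lemma sum_divisors_moebius_filter_dvd {g q : ℕ} (hg : g ≠ 0) :
    ∑ a ∈ g.divisors, (if a ∣ q then ((ArithmeticFunction.moebius a : ℤ) : ℝ) else 0) =
      if Nat.gcd g q = 1 then 1 else 0 := by
  have hdiv : g.divisors.filter (· ∣ q) = (Nat.gcd g q).divisors := by
    ext a
    simp [Nat.dvd_gcd_iff, hg]
  rw [← Finset.sum_filter, hdiv, ← Int.cast_sum, ← ArithmeticFunction.coe_mul_zeta_apply,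
    ArithmeticFunction.moebius_mul_coe_zeta, ArithmeticFunction.one_apply]
  split_ifs <;> simp

/-- Möbius detection of `gcd g q = 1` on the divisors `q` of `D`, written over `r = D / q`. -/
lemma sum_divisors_div_eq {D g : ℕ} (hg : g ≠ 0) (w : ℕ → ℝ) :
    ∑ a ∈ g.divisors, ∑ r ∈ D.divisors,
        (if a * r ∣ D then ((ArithmeticFunction.moebius a : ℤ) : ℝ) * w (D / r) else 0) =
      ∑ q ∈ D.divisors, if Nat.gcd g q = 1 then w q else 0 := by
  have hflip (a : ℕ) : ∑ r ∈ D.divisors,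
        (if a * r ∣ D then ((ArithmeticFunction.moebius a : ℤ) : ℝ) * w (D / r) else 0) =
      ∑ q ∈ D.divisors, if a ∣ q then ((ArithmeticFunction.moebius a : ℤ) : ℝ) * w q else 0 := by
    rw [← Nat.sum_div_divisors D
      (fun q ↦ if a ∣ q then ((ArithmeticFunction.moebius a : ℤ) : ℝ) * w q else 0)]
    refine Finset.sum_congr rfl fun r hr ↦ ?_
    have hrD := Nat.dvd_of_mem_divisors hr
    simp only [Nat.dvd_div_iff_mul_dvd hrD, mul_comm a r]
  simp only [hflip]
  rw [Finset.sum_comm]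
  refine Finset.sum_congr rfl fun q _ ↦ ?_
  calc _ = (∑ a ∈ g.divisors,
        (if a ∣ q then ((ArithmeticFunction.moebius a : ℤ) : ℝ) else 0)) * w q := by
        rw [Finset.sum_mul]
        exact Finset.sum_congr rfl fun a _ ↦ by split_ifs <;> simp
    _ = _ := by
      rw [sum_divisors_moebius_filter_dvd hg]
      split_ifs <;> simp

lemma sum_reduced_residues_indicator {q : ℕ} (hq : 1 ≤ q) (n : ℕ) :
    ∑ a ∈ (Finset.Icc 1 q).filter (fun a ↦ Nat.gcd a q = 1),
        (if n ≡ a [MOD q] then (1 : ℝ) else 0) =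
      if Nat.gcd n q = 1 then 1 else 0 := by
  split_ifs with h
  · obtain ⟨a, ha, hna⟩ : ∃ a ∈ Finset.Icc 1 q, n ≡ a [MOD q] := by
      by_cases h0 : n % q = 0
      · exact ⟨q, by simp [hq], by simp [Nat.ModEq, h0]⟩
      · refine ⟨n % q, ?_, (Nat.mod_modEq n q).symm⟩
        have := Nat.mod_lt n hq
        simp only [Finset.mem_Icc]
        omega
    rw [Finset.sum_eq_single_of_mem a, if_pos hna]
    · exact Finset.mem_filter.2 ⟨ha, hna.gcd_eq ▸ h⟩
    · intro b hb hba
      refine if_neg fun hnb ↦ hba ?_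
      have hb' := (Finset.mem_filter.1 hb).1
      simp only [Finset.mem_Icc] at ha hb'
      refine (hnb.symm.trans hna).eq_of_abs_lt ?_
      rw [abs_lt]
      omega
  · refine Finset.sum_eq_zero fun a ha ↦ if_neg fun hna ↦ h ?_
    rw [hna.gcd_eq]
    exact (Finset.mem_filter.1 ha).2

/-- Expansion of the variance over reduced residue classes. -/
lemma sum_reduced_residues_sq_sub {q : ℕ} (hq : 1 ≤ q) (s : Finset ℕ) (f : ℕ → ℝ) :
    (∑ a ∈ Finset.Icc 1 q, if Nat.gcd a q = 1 then
        ((∑ n ∈ s, if n ≡ a [MOD q] then f n else 0) -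
          (1 / (q.totient : ℝ)) * ∑ n ∈ s, if Nat.gcd n q = 1 then f n else 0) ^ 2 else 0) =
      (∑ m ∈ s, ∑ n ∈ s, if m ≡ n [MOD q] ∧ Nat.gcd m q = 1 then f m * f n else 0) -
        (1 / (q.totient : ℝ)) * (∑ n ∈ s, if Nat.gcd n q = 1 then f n else 0) ^ 2 := by
  set A := (Finset.Icc 1 q).filter (fun a ↦ Nat.gcd a q = 1) with hA
  generalize hC : ∑ n ∈ s, (if Nat.gcd n q = 1 then f n else 0) = C
  set P : ℕ → ℝ := fun a ↦ ∑ n ∈ s, if n ≡ a [MOD q] then f n else 0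
  have hcard : (A.card : ℝ) = q.totient := by
    rw [← Nat.filter_coprime_Ico_eq_totient q 1, hA]
    congr 2
    ext a
    simp only [Finset.mem_filter, Finset.mem_Icc, Finset.mem_Ico, Nat.coprime_iff_gcd_eq_one,
      Nat.gcd_comm a q, Nat.lt_one_add_iff]
  have hφ : (q.totient : ℝ) ≠ 0 := by
    exact_mod_cast (Nat.totient_pos.2 hq).ne'
  have hP : ∑ a ∈ A, P a = C := by
    rw [← hC, Finset.sum_comm]
    refine Finset.sum_congr rfl fun n _ ↦ ?_
    have := congrArg (· * f n) (sum_reduced_residues_indicator hq n)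
    simpa only [Finset.sum_mul, ite_mul, one_mul, zero_mul] using this
  have hP2 : ∑ a ∈ A, P a ^ 2 =
      ∑ m ∈ s, ∑ n ∈ s, if m ≡ n [MOD q] ∧ Nat.gcd m q = 1 then f m * f n else 0 := by
    simp only [P, sq, Finset.sum_mul_sum]
    rw [Finset.sum_comm]
    refine Finset.sum_congr rfl fun m _ ↦ ?_
    rw [Finset.sum_comm]
    refine Finset.sum_congr rfl fun n _ ↦ ?_
    have := congrArg (· * (if m ≡ n [MOD q] then f m * f n else 0))
      (sum_reduced_residues_indicator hq m)
    simp only [Finset.sum_mul, ite_mul, one_mul, zero_mul, ← ite_and] at this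
    simp only [and_comm (a := m ≡ n [MOD q]), ← this]
    refine Finset.sum_congr rfl fun a _ ↦ ?_
    by_cases hm : m ≡ a [MOD q]
    · have hiff : n ≡ a [MOD q] ↔ m ≡ n [MOD q] :=
        ⟨fun h ↦ hm.trans h.symm, fun h ↦ h.symm.trans hm⟩
      simp [hm, hiff]
    · simp [hm]
  calc _ = ∑ a ∈ A, (P a - 1 / (q.totient : ℝ) * C) ^ 2 := (Finset.sum_filter _ _).symm
    _ = ∑ a ∈ A, P a ^ 2 - 2 * (1 / (q.totient : ℝ) * C) * ∑ a ∈ A, P a +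
          A.card * (1 / (q.totient : ℝ) * C) ^ 2 := by
        rw [Finset.mul_sum, ← Finset.sum_sub_distrib, ← nsmul_eq_mul, ← Finset.sum_const,
          ← Finset.sum_add_distrib]
        exact Finset.sum_congr rfl fun a _ ↦ by ring
    _ = _ := by
        rw [hP, hP2, hcard]
        field_simp
        ring

lemma exists_forall_ge_eq_zero_of_hasCompactSupport {F : ℝ → ℝ} (hF : HasCompactSupport F)
    {Y : ℝ} (hY : 0 < Y) : ∃ N : ℕ, ∀ n : ℕ, N ≤ n → F ((n : ℝ) / Y) = 0 := by
  obtain ⟨B, hB⟩ := hF.isCompact.bddAbove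
  obtain ⟨N, hN⟩ := exists_nat_gt (B * Y)
  refine ⟨N, fun n hn ↦ image_eq_zero_of_notMem_tsupport fun hmem ↦ ?_⟩
  have h₁ : (n : ℝ) / Y ≤ B := hB hmem
  rw [div_le_iff₀ hY] at h₁
  have h₂ : (N : ℝ) ≤ n := by exact_mod_cast hn
  linarith

lemma finite_support_div_natCast_mul {F : ℝ → ℝ} (hF : tsupport F ⊆ Set.Ioi 0) (D Y : ℝ) :
    (Function.support fun r : ℕ ↦ F (D / ((r : ℝ) * Y))).Finite := by
  have h0 : F =ᶠ[nhds 0] 0 := notMem_tsupport_iff_eventuallyEq.1 fun h ↦ lt_irrefl (0 : ℝ) (hF h)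
  have hlim : Filter.Tendsto (fun r : ℕ ↦ D / ((r : ℝ) * Y)) Filter.atTop (nhds 0) := by
    have := tendsto_const_div_atTop_nhds_zero_nat (D / Y)
    refine this.congr fun r ↦ ?_
    rw [div_div, mul_comm]
  have := hlim.eventually h0
  rw [← Nat.cofinite_eq_atTop] at this
  exact this

/-- Congruence of `m, n` modulo a coprime modulus, in terms of the reduced pair. -/
lemma modEq_and_gcd_eq_one_iff {m n q : ℕ} (hm : 1 ≤ m) :
    (m ≡ n [MOD q] ∧ Nat.gcd m q = 1) ↔
      (m / Nat.gcd m n ≡ n / Nat.gcd m n [MOD q] ∧ Nat.gcd (Nat.gcd m n) q = 1) := by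
  have hg : 0 < Nat.gcd m n := Nat.gcd_pos_of_pos_left n hm
  obtain ⟨M, N, hMN, hmM, hnN⟩ := Nat.exists_coprime m n
  set g := Nat.gcd m n
  have hM : m / g = M := by rw [hmM]; exact Nat.mul_div_cancel _ hg
  have hN : n / g = N := by rw [hnN]; exact Nat.mul_div_cancel _ hg
  rw [hM, hN, hmM, hnN]
  constructor
  · rintro ⟨h, hc⟩
    have hgq : Nat.gcd g q = 1 := Nat.Coprime.coprime_mul_left (k := M) hc
    exact ⟨Nat.ModEq.cancel_right_of_coprime (by rwa [Nat.gcd_comm]) h, hgq⟩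
  · rintro ⟨h, hgq⟩
    exact ⟨h.mul_right g, Nat.Coprime.mul_left (coprime_of_modEq_of_coprime hMN h) hgq⟩

lemma modEq_iff_dvd_natAbs_sub {q M N : ℕ} :
    M ≡ N [MOD q] ↔ q ∣ ((M : ℤ) - N).natAbs := by
  rw [Nat.modEq_iff_dvd, ← Int.natCast_dvd, ← neg_sub, dvd_neg]

/-- The principal and non-principal contributions for fixed `a` add up to a sum over the
divisors of `|M - N|`. -/
lemma tsum_principal_add_tsum_nonprincipal {Φ : ℝ → ℝ} (hΦ : tsupport Φ ⊆ Set.Ioi 0)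
    {a M N : ℕ} (ha : 1 ≤ a) (hMN : Nat.Coprime M N) (c b Q : ℝ) :
    ((∑' r : ℕ, if 1 ≤ r ∧ Nat.gcd (a * r) (M * N) = 1 then
        c * (b / (Nat.totient (a * r) : ℝ)) * Φ (|(M : ℝ) - (N : ℝ)| / ((r : ℝ) * Q))
        else 0 : ℝ) : ℂ) +
      ∑' r : ℕ, (if 1 ≤ r then
        ((c * (b / (Nat.totient (a * r) : ℝ)) *
            Φ (|(M : ℝ) - (N : ℝ)| / ((r : ℝ) * Q)) : ℝ) : ℂ) *
          ∑' χ : DirichletCharacter ℂ (a * r),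
            (if χ ≠ 1 then
              χ ((M : ZMod (a * r))) * (starRingEnd ℂ) (χ ((N : ZMod (a * r)))) else 0)
        else 0) =
      ((c * ∑ r ∈ ((M : ℤ) - N).natAbs.divisors,
        if a * r ∣ ((M : ℤ) - N).natAbs then
          b * Φ (((((M : ℤ) - N).natAbs / r : ℕ) : ℝ) / Q) else 0 : ℝ) : ℂ) := by
  have hΦ0 : Φ 0 = 0 := image_eq_zero_of_notMem_tsupport fun h ↦ lt_irrefl (0 : ℝ) (hΦ h)
  have habs : |(M : ℝ) - (N : ℝ)| = (((M : ℤ) - N).natAbs : ℝ) := by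
    rw [Nat.cast_natAbs]
    push_cast
    rfl
  rw [habs]
  have hdvd (q : ℕ) : M ≡ N [MOD q] ↔ q ∣ ((M : ℤ) - N).natAbs := modEq_iff_dvd_natAbs_sub
  set D := ((M : ℤ) - N).natAbs
  have hfin := finite_support_div_natCast_mul hΦ (D : ℝ) Q
  rw [Complex.ofReal_tsum, ← Summable.tsum_add]
  · have hterm (r : ℕ) : (((if 1 ≤ r ∧ Nat.gcd (a * r) (M * N) = 1 then
          c * (b / (Nat.totient (a * r) : ℝ)) * Φ ((D : ℝ) / ((r : ℝ) * Q)) else 0 : ℝ) : ℂ) +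
        if 1 ≤ r then
          ((c * (b / (Nat.totient (a * r) : ℝ)) * Φ ((D : ℝ) / ((r : ℝ) * Q)) : ℝ) : ℂ) *
          ∑' χ : DirichletCharacter ℂ (a * r),
            (if χ ≠ 1 then
              χ ((M : ZMod (a * r))) * (starRingEnd ℂ) (χ ((N : ZMod (a * r)))) else 0)
        else 0) =
        ((if 1 ≤ r ∧ a * r ∣ D then c * (b * Φ ((D : ℝ) / ((r : ℝ) * Q))) else 0 : ℝ) : ℂ) := by
      by_cases hr : 1 ≤ r
      · have har : a * r ≠ 0 := by positivity
        have hφ : ((a * r).totient : ℂ) ≠ 0 := by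
          exact_mod_cast (Nat.totient_pos.2 (Nat.pos_of_ne_zero har)).ne'
        have key := principal_add_sum_nonprincipal har hMN
        simp only [hdvd] at key
        have hcomb (x y : ℂ) (hy : (if Nat.gcd (a * r) (M * N) = 1 then (1 : ℂ) else 0) + y =
            if a * r ∣ D then ((a * r).totient : ℂ) else 0) :
            (if Nat.gcd (a * r) (M * N) = 1 then x else 0) + x * y =
              if a * r ∣ D then x * ((a * r).totient : ℂ) else 0 := by
          have := congrArg (x * ·) hy
          simpa only [mul_add, mul_ite, mul_one, mul_zero] using this
        have := hcomb
          ((c * (b / (Nat.totient (a * r) : ℝ)) * Φ ((D : ℝ) / ((r : ℝ) * Q)) : ℝ) : ℂ) _ key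
        simp only [hr, true_and, if_true, apply_ite Complex.ofReal, Complex.ofReal_zero]
        refine this.trans ?_
        congr 1
        push_cast
        field_simp
      · simp [hr]
    simp only [hterm]
    rw [← Complex.ofReal_tsum, tsum_eq_sum (s := D.divisors), Finset.mul_sum]
    · congr 1
      refine Finset.sum_congr rfl fun r hr ↦ ?_
      have hr0 : (r : ℝ) ≠ 0 := by exact_mod_cast (Nat.pos_of_mem_divisors hr).ne'
      rw [Nat.cast_div (Nat.dvd_of_mem_divisors hr) hr0, div_div, mul_ite, mul_zero]
      simp only [Nat.one_le_iff_ne_zero.2 (Nat.pos_of_mem_divisors hr).ne', true_and]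
    · intro r hr
      by_cases hD : D = 0
      · simp [hD, hΦ0]
      · refine if_neg fun h ↦ hr (Nat.mem_divisors.2 ⟨?_, hD⟩)
        exact (dvd_mul_left r a).trans h.2
  · refine summable_of_hasFiniteSupport (hfin.subset fun r hr hr0 ↦ hr ?_)
    simp [hr0]
  · refine summable_of_hasFiniteSupport (hfin.subset fun r hr hr0 ↦ hr ?_)
    simp [hr0]

/-- The contribution of a fixed pair `(m, n)` to the off-diagonal sums. -/
lemma tsum_offDiagonal_pair {Φ : ℝ → ℝ} (hΦ : tsupport Φ ⊆ Set.Ioi 0)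
    {m n : ℕ} (hm : 1 ≤ m) (hn : 1 ≤ n) (c Q : ℝ) :
    ((∑' a : ℕ, ∑' r : ℕ,
      if 1 ≤ m ∧ 1 ≤ n ∧ 1 ≤ r ∧ a ∣ Nat.gcd m n ∧
          Nat.gcd (a * r) ((m / Nat.gcd m n) * (n / Nat.gcd m n)) = 1 then
        c * (((ArithmeticFunction.moebius a : ℤ) : ℝ) / (Nat.totient (a * r) : ℝ)) *
          Φ (|((m / Nat.gcd m n : ℕ) : ℝ) - ((n / Nat.gcd m n : ℕ) : ℝ)| / ((r : ℝ) * Q))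
      else 0 : ℝ) : ℂ) +
    (∑' a : ℕ, ∑' r : ℕ,
      if 1 ≤ m ∧ 1 ≤ n ∧ 1 ≤ r ∧ a ∣ Nat.gcd m n then
        ((c * (((ArithmeticFunction.moebius a : ℤ) : ℝ) / (Nat.totient (a * r) : ℝ)) *
          Φ (|((m / Nat.gcd m n : ℕ) : ℝ) - ((n / Nat.gcd m n : ℕ) : ℝ)| /
              ((r : ℝ) * Q)) : ℝ) : ℂ) *
        ∑' χ : DirichletCharacter ℂ (a * r),
          (if χ ≠ 1 then
            χ (((m / Nat.gcd m n : ℕ) : ZMod (a * r))) *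
              (starRingEnd ℂ) (χ (((n / Nat.gcd m n : ℕ) : ZMod (a * r))))
          else 0)
      else 0) =
    ((c * ∑ q ∈ (((m / Nat.gcd m n : ℕ) : ℤ) - ((n / Nat.gcd m n : ℕ) : ℤ)).natAbs.divisors,
      if Nat.gcd (Nat.gcd m n) q = 1 then Φ ((q : ℝ) / Q) else 0 : ℝ) : ℂ) := by
  have hg : 0 < Nat.gcd m n := Nat.gcd_pos_of_pos_left n hm
  have hMN := Nat.coprime_div_gcd_div_gcd hg
  have hnot {a : ℕ} (ha : a ∉ (Nat.gcd m n).divisors) : ¬ a ∣ Nat.gcd m n :=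
    fun h ↦ ha (Nat.mem_divisors.2 ⟨h, hg.ne'⟩)
  rw [tsum_eq_sum (s := (Nat.gcd m n).divisors) fun a ha ↦ by simp [hnot ha],
    tsum_eq_sum (s := (Nat.gcd m n).divisors) fun a ha ↦ by simp [hnot ha],
    ← sum_divisors_div_eq hg.ne' (fun q ↦ Φ ((q : ℝ) / Q)), Complex.ofReal_sum,
    ← Finset.sum_add_distrib, Finset.mul_sum, Complex.ofReal_sum]
  refine Finset.sum_congr rfl fun a ha ↦ ?_
  rw [← tsum_principal_add_tsum_nonprincipal hΦ (Nat.pos_of_mem_divisors ha) hMN c]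
  simp only [hm, hn, true_and, Nat.dvd_of_mem_divisors ha, and_true]

/-- The weighted count of moduli `q` for a pair `m ≠ n` as a sum over divisors. -/
lemma sum_moduli_eq_sum_divisors {m n : ℕ} (hm : 1 ≤ m) (hmn : m ≠ n) (t : Finset ℕ)
    (w : ℕ → ℝ) (hw : ∀ q ∉ t, w q = 0) :
    ∑ q ∈ t, (if m ≡ n [MOD q] ∧ Nat.gcd m q = 1 then w q else 0) =
      ∑ q ∈ (((m / Nat.gcd m n : ℕ) : ℤ) - ((n / Nat.gcd m n : ℕ) : ℤ)).natAbs.divisors,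
        if Nat.gcd (Nat.gcd m n) q = 1 then w q else 0 := by
  have hne : (((m / Nat.gcd m n : ℕ) : ℤ) - ((n / Nat.gcd m n : ℕ) : ℤ)).natAbs ≠ 0 := by
    rw [Int.natAbs_ne_zero, sub_ne_zero]
    intro h
    refine hmn ?_
    rw [← Nat.div_mul_cancel (Nat.gcd_dvd_left m n), Nat.cast_inj.1 h,
      Nat.div_mul_cancel (Nat.gcd_dvd_right m n)]
  have hiff (q : ℕ) := modEq_and_gcd_eq_one_iff (n := n) (q := q) hm
  simp only [modEq_iff_dvd_natAbs_sub (M := m / Nat.gcd m n)] at hiff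
  simp only [hiff]
  rw [← tsum_eq_sum (L := .unconditional ℕ) fun q hq ↦ by simp [hw q hq],
    tsum_eq_sum fun q hq ↦ if_neg fun h ↦ hq (Nat.mem_divisors.2 ⟨h.1, hne⟩)]
  refine Finset.sum_congr rfl fun q hq ↦ ?_
  simp only [Nat.dvd_of_mem_divisors hq, true_and]

/-- the exact decomposition `Δ_k = D_k − B_k + MG_k + EG_k`. -/
theorem variance_decomposition (k : ℕ) (hk : 2 ≤ k)
    (Φ Ψ : ℝ → ℝ)
    (hΦsmooth : ContDiff ℝ (⊤ : ℕ∞) Φ) (hΦsupp : HasCompactSupport Φ)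
    (hΦpos : ∀ x, 0 ≤ Φ x) (hΦsupp' : tsupport Φ ⊆ Set.Ioi 0)
    (hΦint : ∫ u, Φ u = 1)
    (hΨsmooth : ContDiff ℝ (⊤ : ℕ∞) Ψ) (hΨsupp : HasCompactSupport Ψ)
    (hΨpos : ∀ x, 0 ≤ Ψ x) (hΨsupp' : tsupport Ψ ⊆ Set.Ioi 0)
    (hΨint : ∫ u, (Ψ u)^2 = 1)
    (Q X : ℝ) (hQ : 0 < Q) (hX : 0 < X) :
    (DeltaK k Φ Ψ Q X : ℂ) =
      (Dk k Φ Ψ Q X : ℂ) - (Bk k Φ Ψ Q X : ℂ) + (MGk k Φ Ψ Q X : ℂ)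
        + EGk k Φ Ψ Q X := by
  have hsupp {F : ℝ → ℝ} (hF : HasCompactSupport F) (hF' : tsupport F ⊆ Set.Ioi 0)
      {Y : ℝ} (hY : 0 < Y) : ∃ s : Finset ℕ, (∀ n ∈ s, 1 ≤ n) ∧
        ∀ n ∉ s, F ((n : ℝ) / Y) = 0 := by
    obtain ⟨N, hN⟩ := exists_forall_ge_eq_zero_of_hasCompactSupport hF hY
    refine ⟨Finset.Ico 1 N, fun n hn ↦ (Finset.mem_Ico.1 hn).1, fun n hn ↦ ?_⟩
    rcases Nat.eq_zero_or_pos n with rfl | hpos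
    · rw [Nat.cast_zero, zero_div]
      exact image_eq_zero_of_notMem_tsupport fun h ↦ lt_irrefl (0 : ℝ) (hF' h)
    · exact hN n (not_lt.1 fun h ↦ hn (Finset.mem_Ico.2 ⟨hpos, h⟩))
  obtain ⟨s, hs1, hs⟩ := hsupp hΨsupp hΨsupp' hX
  obtain ⟨t, ht1, ht⟩ := hsupp hΦsupp hΦsupp' hQ
  set f : ℕ → ℝ := fun n ↦ (dk k n : ℝ) * Ψ ((n : ℝ) / X) with hf
  have hprog (q a : ℕ) : progSum k Ψ q a X = ∑ n ∈ s, if n ≡ a [MOD q] then f n else 0 := by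
    rw [progSum, tsum_eq_sum (s := s) fun n hn ↦ by simp [hs n hn]]
    simp only [ZMod.natCast_eq_natCast_iff, hf]
  have hcop (q : ℕ) : copSum k Ψ q X = ∑ n ∈ s, if Nat.gcd n q = 1 then f n else 0 := by
    rw [copSum, tsum_eq_sum (s := s) fun n hn ↦ by simp [hs n hn]]
  have hV (q : ℕ) (hq : 1 ≤ q) : Vk k Ψ q X =
      (∑ m ∈ s, ∑ n ∈ s, if m ≡ n [MOD q] ∧ Nat.gcd m q = 1 then f m * f n else 0) -
        (1 / (q.totient : ℝ)) * copSum k Ψ q X ^ 2 := by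
    rw [hcop, ← sum_reduced_residues_sq_sub hq]
    simp only [Vk, hprog, hcop]
  have hΔ : DeltaK k Φ Ψ Q X = ∑ q ∈ t, Vk k Ψ q X * Φ ((q : ℝ) / Q) := by
    rw [DeltaK, tsum_eq_sum (s := t) fun q hq ↦ by simp [ht q hq]]
    exact Finset.sum_congr rfl fun q hq ↦ if_pos (ht1 q hq)
  have hB : Bk k Φ Ψ Q X =
      ∑ q ∈ t, Φ ((q : ℝ) / Q) * (1 / (q.totient : ℝ)) * copSum k Ψ q X ^ 2 := by
    rw [Bk, tsum_eq_sum (s := t) fun q hq ↦ by simp [ht q hq]]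
    exact Finset.sum_congr rfl fun q hq ↦ if_pos (ht1 q hq)
  have hD : Dk k Φ Ψ Q X =
      ∑ q ∈ t, Φ ((q : ℝ) / Q) * ∑ n ∈ s, if Nat.gcd n q = 1 then f n * f n else 0 := by
    rw [Dk, tsum_eq_sum (s := t) fun q hq ↦ by simp [ht q hq]]
    refine Finset.sum_congr rfl fun q hq ↦ ?_
    rw [if_pos (ht1 q hq), tsum_eq_sum (s := s) fun n hn ↦ by simp [hs n hn]]
    congr 1
    refine Finset.sum_congr rfl fun n _ ↦ ?_
    congr 1
    simp only [hf]
    ring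
  have hoff : (MGk k Φ Ψ Q X : ℂ) + EGk k Φ Ψ Q X =
      ((∑ m ∈ s, ∑ n ∈ s, f m * f n *
        ∑ q ∈ (((m / Nat.gcd m n : ℕ) : ℤ) - ((n / Nat.gcd m n : ℕ) : ℤ)).natAbs.divisors,
          if Nat.gcd (Nat.gcd m n) q = 1 then Φ ((q : ℝ) / Q) else 0 : ℝ) : ℂ) := by
    rw [MGk, EGk, tsum_eq_sum (s := s) fun m hm ↦ by simp [hs m hm],
      tsum_eq_sum (s := s) fun m hm ↦ by simp [hs m hm], Complex.ofReal_sum, Complex.ofReal_sum,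
      ← Finset.sum_add_distrib]
    refine Finset.sum_congr rfl fun m hm ↦ ?_
    rw [tsum_eq_sum (s := s) fun n hn ↦ by simp [hs n hn],
      tsum_eq_sum (s := s) fun n hn ↦ by simp [hs n hn], Complex.ofReal_sum, Complex.ofReal_sum,
      ← Finset.sum_add_distrib]
    refine Finset.sum_congr rfl fun n hn ↦ ?_
    rw [tsum_offDiagonal_pair hΦsupp' (hs1 m hm) (hs1 n hn)]
    congr 2
    simp only [hf]
    ring
  have hpair (m : ℕ) (hm : m ∈ s) (n : ℕ) : f m * f n *
        ∑ q ∈ (((m / Nat.gcd m n : ℕ) : ℤ) - ((n / Nat.gcd m n : ℕ) : ℤ)).natAbs.divisors,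
          (if Nat.gcd (Nat.gcd m n) q = 1 then Φ ((q : ℝ) / Q) else 0) =
      ∑ q ∈ t, Φ ((q : ℝ) / Q) *
        ((if m ≡ n [MOD q] ∧ Nat.gcd m q = 1 then f m * f n else 0) -
          if m = n then (if Nat.gcd m q = 1 then f m * f m else 0) else 0) := by
    by_cases hmn : m = n
    · subst hmn
      simp [Nat.ModEq.refl]
    · rw [← sum_moduli_eq_sum_divisors (hs1 m hm) hmn t (fun q ↦ Φ ((q : ℝ) / Q)) ht,
        Finset.mul_sum]
      refine Finset.sum_congr rfl fun q _ ↦ ?_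
      rw [if_neg hmn]
      split_ifs <;> ring
  have hreal : DeltaK k Φ Ψ Q X = Dk k Φ Ψ Q X - Bk k Φ Ψ Q X +
      ∑ m ∈ s, ∑ n ∈ s, f m * f n *
        ∑ q ∈ (((m / Nat.gcd m n : ℕ) : ℤ) - ((n / Nat.gcd m n : ℕ) : ℤ)).natAbs.divisors,
          if Nat.gcd (Nat.gcd m n) q = 1 then Φ ((q : ℝ) / Q) else 0 := by
    have hswap : (∑ m ∈ s, ∑ n ∈ s, f m * f n *
        ∑ q ∈ (((m / Nat.gcd m n : ℕ) : ℤ) - ((n / Nat.gcd m n : ℕ) : ℤ)).natAbs.divisors,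
          if Nat.gcd (Nat.gcd m n) q = 1 then Φ ((q : ℝ) / Q) else 0) =
        ∑ q ∈ t, Φ ((q : ℝ) / Q) *
          ((∑ m ∈ s, ∑ n ∈ s, if m ≡ n [MOD q] ∧ Nat.gcd m q = 1 then f m * f n else 0) -
            ∑ m ∈ s, if Nat.gcd m q = 1 then f m * f m else 0) := by
      rw [Finset.sum_congr rfl fun m hm ↦ Finset.sum_congr rfl fun n _ ↦ hpair m hm n]
      rw [Finset.sum_congr rfl fun m _ ↦ Finset.sum_comm, Finset.sum_comm]
      refine Finset.sum_congr rfl fun q _ ↦ ?_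
      rw [← Finset.sum_sub_distrib, Finset.mul_sum]
      refine Finset.sum_congr rfl fun m hm ↦ ?_
      rw [← Finset.mul_sum, Finset.sum_sub_distrib, Finset.sum_ite_eq, if_pos hm]
    rw [hswap, hΔ, hD, hB, ← Finset.sum_sub_distrib, ← Finset.sum_add_distrib]
    refine Finset.sum_congr rfl fun q hq ↦ ?_
    rw [hV q (ht1 q hq)]
    ring
  rw [add_assoc, hoff, hreal]
  push_cast
  ring
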